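/- Let ((ω_n(j))_{j=0}^{q_n−1})_{n∈ℕ} be arrays of real numbers such that for each n the numbers ω_n(0), …, ω_n(q_n−1) are rationally independent, and q_n → ∞. Then the asymptotic mean value of |(1/√q_n) Σ_{j=0}^{q_n−1} e^{iω_n(j)t}| converges to √(π/2) as n → ∞. In particular, no such sequence of polynomials is L¹-flat (since √(π/2)/... < 1, the ratio ‖P_n‖₁/‖P_n‖₂ → √π/2 < 1). -/

import Mathlib

open MeasureTheory Filter

/-- The asymptotic mean value of a real-valued function on `ℝ`. -/
def HasMeanValue (f : ℝ → ℝ) (A : ℝ) : Prop :=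
  Tendsto (fun T : ℝ => (1 / (2 * T)) * ∫ t in (-T)..T, f t) atTop (nhds A)

namespace L1Flat
open ProbabilityTheory

/-- Haar probability measure on the circle. -/
noncomputable abbrev mu0 : Measure UnitAddCircle := AddCircle.haarAddCircle

/-- Product measure on the infinite torus. -/
noncomputable abbrev PP : Measure (ℕ → UnitAddCircle) := Measure.infinitePi (fun _ : ℕ => mu0)

lemma int_fourier (k : ℤ) : ∫ x, (fourier k x : ℂ) ∂mu0 = if k = 0 then 1 else 0 := by
  split_ifs with h
  · subst h; simp
  · exact integral_eq_zero_of_add_right_eq_neg (fourier_add_half_inv_index h (by norm_num))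

lemma int_eval {E : Type*} [NormedAddCommGroup E] [NormedSpace ℝ E] (f : UnitAddCircle → E)
    (hf : Continuous f) (i : ℕ) :
    ∫ x, f (x i) ∂PP = ∫ y, f y ∂mu0 := by
  have h := Measure.infinitePi_map_eval (fun _ : ℕ => mu0) i
  rw [← h, integral_map (measurable_pi_apply i).aemeasurable]
  exact hf.aestronglyMeasurable_of_compactSpace

lemma indep0 : iIndepFun (fun (i : ℕ) (x : ℕ → UnitAddCircle) => x i) PP :=
  iIndepFun_infinitePi (X := fun _ y => y) (fun _ => measurable_id)

lemma int_mFourier (q : ℕ) (k : Fin q → ℤ) :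
    ∫ x, UnitAddTorus.mFourier k (fun i : Fin q => x i) ∂PP = if k = 0 then 1 else 0 := by
  have hind : iIndepFun (fun (i : Fin q) (x : ℕ → UnitAddCircle) => (fourier (k i) (x i) : ℂ)) PP := by
    have h1 := indep0.precomp (g := fun i : Fin q => (i : ℕ)) Fin.val_injective
    exact h1.comp (fun i y => (fourier (k i) y : ℂ)) (fun i => (fourier (k i)).continuous.measurable)
  simp only [UnitAddTorus.mFourier, ContinuousMap.coe_mk]
  rw [hind.integral_fun_prod_eq_prod_integral]
  · have : ∀ i : Fin q, ∫ x, (fourier (k i) (x i) : ℂ) ∂PP = if k i = 0 then 1 else 0 := by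
      intro i
      rw [← int_fourier (k i), ← int_eval _ (fourier (k i)).continuous (i : ℕ)]
    simp_rw [this]
    rw [Finset.prod_ite_zero]
    simp [funext_iff]
  · intro i
    have hm : Measurable (fun x : ℕ → UnitAddCircle => x (i : ℕ)) := measurable_pi_apply _
    exact ((fourier (k i)).continuous.measurable.comp hm).aestronglyMeasurable

/-- The linear flow on the torus. -/
noncomputable def gam {q : ℕ} (w : Fin q → ℝ) (t : ℝ) : UnitAddTorus (Fin q) :=
  fun i => ((w i * t / (2 * Real.pi) : ℝ) : UnitAddCircle)

lemma gam_cont {q : ℕ} (w : Fin q → ℝ) : Continuous (gam w) := by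
  refine continuous_pi fun i => ?_
  exact (AddCircle.continuous_mk' 1).comp (by fun_prop)

lemma mFourier_gam {q : ℕ} (w : Fin q → ℝ) (k : Fin q → ℤ) (t : ℝ) :
    UnitAddTorus.mFourier k (gam w t) = Complex.exp (Complex.I * ((∑ i, (k i : ℝ) * w i : ℝ) : ℂ) * t) := by
  simp only [UnitAddTorus.mFourier, ContinuousMap.coe_mk, gam, fourier_coe_apply]
  rw [← Complex.exp_sum]
  congr 1
  push_cast
  rw [Finset.mul_sum, Finset.sum_mul]
  refine Finset.sum_congr rfl fun i _ => ?_
  have : (Real.pi : ℂ) ≠ 0 := by exact_mod_cast Real.pi_ne_zero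
  field_simp

lemma tm_zero : Tendsto (fun T : ℝ => 1 / T) atTop (nhds 0) := by
  simpa using tendsto_inv_atTop_zero (𝕜 := ℝ)

/-- Time average. -/
noncomputable def tav {q : ℕ} (w : Fin q → ℝ) (T : ℝ) (F : C(UnitAddTorus (Fin q), ℂ)) : ℂ :=
  ((1 / (2 * T) : ℝ) : ℂ) * ∫ t in (-T)..T, F (gam w t)

/-- Space average. -/
noncomputable def sav {q : ℕ} (F : C(UnitAddTorus (Fin q), ℂ)) : ℂ :=
  ∫ x, F (fun i : Fin q => x i) ∂PP

lemma ii {q : ℕ} (w : Fin q → ℝ) (F : C(UnitAddTorus (Fin q), ℂ)) (a b : ℝ) :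
    IntervalIntegrable (fun t => F (gam w t)) volume a b :=
  (F.continuous.comp (gam_cont w)).intervalIntegrable _ _

lemma meas_res (q : ℕ) : Measurable (fun (x : ℕ → UnitAddCircle) (i : Fin q) => x i) := by
  exact measurable_pi_lambda _ fun i => measurable_pi_apply _

lemma si {q : ℕ} (F : C(UnitAddTorus (Fin q), ℂ)) :
    Integrable (fun x : ℕ → UnitAddCircle => F (fun i : Fin q => x i)) PP := by
  refine Integrable.of_bound (C := ‖F‖) ?_ (Eventually.of_forall fun x => F.norm_coe_le_norm _)
  exact (F.continuous.measurable.comp (meas_res q)).aestronglyMeasurable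

lemma tav_add {q : ℕ} (w : Fin q → ℝ) (T : ℝ) (F G : C(UnitAddTorus (Fin q), ℂ)) :
    tav w T (F + G) = tav w T F + tav w T G := by
  simp only [tav, ContinuousMap.add_apply]
  rw [intervalIntegral.integral_add (ii w F _ _) (ii w G _ _), mul_add]

lemma tav_smul {q : ℕ} (w : Fin q → ℝ) (T : ℝ) (c : ℂ) (F : C(UnitAddTorus (Fin q), ℂ)) :
    tav w T (c • F) = c * tav w T F := by
  simp only [tav, ContinuousMap.smul_apply, smul_eq_mul]
  rw [intervalIntegral.integral_const_mul]; ring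

lemma sav_add {q : ℕ} (F G : C(UnitAddTorus (Fin q), ℂ)) :
    sav (F + G) = sav F + sav G := by
  simp only [sav, ContinuousMap.add_apply]
  rw [integral_add (si F) (si G)]

lemma sav_smul {q : ℕ} (c : ℂ) (F : C(UnitAddTorus (Fin q), ℂ)) :
    sav (c • F) = c * sav F := by
  simp only [sav, ContinuousMap.smul_apply, smul_eq_mul]
  rw [integral_const_mul]

lemma tav_norm {q : ℕ} (w : Fin q → ℝ) (T : ℝ) (hT : 0 < T) (F : C(UnitAddTorus (Fin q), ℂ)) :
    ‖tav w T F‖ ≤ ‖F‖ := by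
  have h := intervalIntegral.norm_integral_le_of_norm_le_const (a := -T) (b := T)
    (f := fun t => F (gam w t)) (C := ‖F‖) (fun t _ => F.norm_coe_le_norm _)
  rw [tav, norm_mul, Complex.norm_real, Real.norm_of_nonneg (by positivity)]
  have h2 : |T - -T| = 2 * T := by rw [abs_of_pos (by linarith)]; ring
  rw [h2] at h
  calc _ ≤ 1 / (2 * T) * (‖F‖ * (2 * T)) := by gcongr
    _ = ‖F‖ := by field_simp

lemma sav_norm {q : ℕ} (F : C(UnitAddTorus (Fin q), ℂ)) : ‖sav F‖ ≤ ‖F‖ := by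
  have h := norm_integral_le_of_norm_le_const (μ := PP)
    (f := fun x : ℕ → UnitAddCircle => F (fun i : Fin q => x i)) (C := ‖F‖)
    (Eventually.of_forall fun x => F.norm_coe_le_norm _)
  simpa [sav] using h

lemma weyl_mono {q : ℕ} (w : Fin q → ℝ) (hw : LinearIndependent ℚ w) (k : Fin q → ℤ) :
    Tendsto (fun T => tav w T (UnitAddTorus.mFourier k)) atTop
      (nhds (sav (UnitAddTorus.mFourier k))) := by
  rw [sav, int_mFourier]
  split_ifs with h
  · refine tendsto_const_nhds.congr' ?_
    filter_upwards [eventually_gt_atTop 0] with T hT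
    subst h
    simp only [tav, UnitAddTorus.mFourier_zero, ContinuousMap.one_apply]
    rw [intervalIntegral.integral_const]
    have : (T : ℂ) ≠ 0 := by exact_mod_cast hT.ne'
    push_cast
    simp
    field_simp
    norm_num
  · set lam : ℝ := ∑ i, (k i : ℝ) * w i with hlam
    have hne : lam ≠ 0 := by
      intro h0
      apply h
      have := Fintype.linearIndependent_iff.1 hw (fun i => (k i : ℚ)) (by
        rw [← h0, hlam]
        refine Finset.sum_congr rfl fun i _ => ?_
        rw [Rat.smul_def]; simp)
      funext i
      exact_mod_cast this i
    have hc : Complex.I * (lam : ℂ) ≠ 0 := mul_ne_zero Complex.I_ne_zero (by exact_mod_cast hne)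
    have hz : Tendsto (fun T : ℝ => (1 / |lam|) * (1 / T)) atTop (nhds 0) := by
      simpa using tm_zero.const_mul (1 / |lam|)
    refine squeeze_zero_norm' ?_ hz
    filter_upwards [eventually_gt_atTop 0] with T hT
    simp only [tav, mFourier_gam, ← hlam]
    rw [integral_exp_mul_complex hc, norm_mul, norm_div, Complex.norm_real,
      Real.norm_of_nonneg (by positivity), norm_mul, Complex.norm_I, Complex.norm_real, one_mul,
      Real.norm_eq_abs]
    have e : ∀ s : ℝ, ‖Complex.exp (Complex.I * lam * s)‖ = 1 := by
      intro s
      rw [Complex.norm_exp]; simp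
    have h2 : ‖Complex.exp (Complex.I * lam * (T : ℝ)) - Complex.exp (Complex.I * lam * ((-T : ℝ)))‖ ≤ 2 := by
      refine (norm_sub_le _ _).trans ?_
      rw [e, e]; norm_num
    have hl : 0 < |lam| := abs_pos.2 hne
    calc _ ≤ 1 / (2 * T) * (2 / |lam|) := by gcongr
      _ = _ := by field_simp

lemma weyl {q : ℕ} (w : Fin q → ℝ) (hw : LinearIndependent ℚ w) (F : C(UnitAddTorus (Fin q), ℂ)) :
    Tendsto (fun T => tav w T F) atTop (nhds (sav F)) := by
  have hspan : ∀ G ∈ Submodule.span ℂ (Set.range (UnitAddTorus.mFourier (d := Fin q))),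
      Tendsto (fun T => tav w T G) atTop (nhds (sav G)) := by
    intro G hG
    induction hG using Submodule.span_induction with
    | mem x hx => obtain ⟨k, rfl⟩ := hx; exact weyl_mono w hw k
    | zero => simp [tav, sav]
    | add x y _ _ hx hy => simp only [tav_add, sav_add]; exact hx.add hy
    | smul c x _ hx => simp only [tav_smul, sav_smul]; exact hx.const_mul c
  have hF : F ∈ (Submodule.span ℂ (Set.range (UnitAddTorus.mFourier (d := Fin q)))).topologicalClosure := by
    rw [UnitAddTorus.span_mFourier_closure_eq_top]; trivial
  rw [← SetLike.mem_coe, Submodule.topologicalClosure_coe, Metric.mem_closure_iff] at hF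
  rw [Metric.tendsto_nhds]
  intro ε hε
  obtain ⟨G, hG, hFG⟩ := hF (ε / 3) (by positivity)
  rw [dist_eq_norm] at hFG
  filter_upwards [Metric.tendsto_nhds.1 (hspan G hG) (ε / 3) (by positivity), eventually_gt_atTop 0] with T h1 hT
  rw [dist_eq_norm] at h1 ⊢
  have e1 : tav w T F = tav w T (F - G) + tav w T G := by rw [← tav_add]; simp
  have e2 : sav F = sav (F - G) + sav G := by rw [← sav_add]; simp
  have h2 := tav_norm w T hT (F - G)
  have h3 := sav_norm (F - G)
  rw [e1, e2]
  calc _ = ‖tav w T (F - G) + (tav w T G - sav G) - sav (F - G)‖ := by congr 1; ring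
    _ ≤ ‖tav w T (F - G)‖ + ‖tav w T G - sav G‖ + ‖sav (F - G)‖ :=
      (norm_sub_le _ _).trans (by gcongr; exact norm_add_le _ _)
    _ < ε := by linarith

/-- Normalised Steinhaus sum. -/
noncomputable def SS (n : ℕ) (x : ℕ → UnitAddCircle) : ℂ :=
  ((Real.sqrt n)⁻¹ : ℝ) • ∑ j ∈ Finset.range n, (fourier 1 (x j) : ℂ)

lemma SS_cont (n : ℕ) : Continuous (SS n) := by
  unfold SS
  have h : Continuous (fun x : ℕ → UnitAddCircle =>
      ∑ j ∈ Finset.range n, (fourier 1 (x j) : ℂ)) := by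
    refine continuous_finsetSum _ fun j _ => ?_
    exact (fourier 1).continuous.comp (continuous_apply j)
  exact h.const_smul ((Real.sqrt n)⁻¹ : ℝ)

lemma fnorm (k : ℤ) (y : UnitAddCircle) : ‖(fourier k y : ℂ)‖ = 1 := by
  rw [fourier_apply]; exact Circle.norm_coe _

lemma SS_bound (n : ℕ) (x : ℕ → UnitAddCircle) : ‖SS n x‖ ≤ (Real.sqrt n)⁻¹ * n := by
  rw [SS, norm_smul, Real.norm_of_nonneg (by positivity)]
  gcongr
  refine (norm_sum_le _ _).trans ?_
  simp [fnorm, -fourier_apply]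

lemma fourier_one_add (a b : UnitAddCircle) :
    (fourier 1 (a + b) : ℂ) = fourier 1 a * fourier 1 b := by
  simp [fourier_apply, AddCircle.toCircle_add]

lemma SS_rot (n : ℕ) (θ : UnitAddCircle) (x : ℕ → UnitAddCircle) :
    SS n (fun i => θ + x i) = fourier 1 θ * SS n x := by
  simp only [SS, fourier_one_add]
  rw [← Finset.mul_sum, mul_smul_comm]

lemma rot_mp (θ : UnitAddCircle) :
    PP.map (fun x i => θ + x i) = PP := by
  have := Measure.infinitePi_map_pi (fun _ : ℕ => mu0) (f := fun _ y => θ + y)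
    (fun _ => measurable_const_add θ)
  rw [this]
  congr 1
  funext i
  exact map_add_left_eq_self mu0 θ

lemma rot (n : ℕ) (θ : UnitAddCircle) :
    ∫ x, |(fourier 1 θ * SS n x).re| ∂PP = ∫ x, |(SS n x).re| ∂PP := by
  conv_rhs => rw [← rot_mp θ]
  rw [integral_map]
  · simp only [SS_rot]
  · exact (measurable_pi_lambda _ fun i => (measurable_const_add θ).comp (measurable_pi_apply i)).aemeasurable
  · exact (Complex.continuous_re.comp (SS_cont n)).abs.measurable.aestronglyMeasurable

lemma int_abs_cos : ∫ θ, |(fourier 1 θ : ℂ).re| ∂mu0 = 2 / Real.pi := by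
  have hv : (volume : Measure UnitAddCircle) = mu0 := by
    rw [AddCircle.volume_eq_smul_haarAddCircle]; simp
  rw [← hv, ← AddCircle.intervalIntegral_preimage 1 (-(1/4))]
  have hre : ∀ a : ℝ, (fourier 1 (a : UnitAddCircle) : ℂ).re = Real.cos (2 * Real.pi * a) := by
    intro a
    rw [fourier_coe_apply]
    have : (2 * Real.pi * Complex.I * ((1 : ℤ) : ℂ) * a / ((1 : ℝ) : ℂ)) = ((2 * Real.pi * a : ℝ) : ℂ) * Complex.I := by
      push_cast; ring
    rw [this, Complex.exp_ofReal_mul_I_re]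
  have hpi := Real.pi_pos
  simp only [hre]
  have hI : ∀ a b : ℝ, IntervalIntegrable (fun a => |Real.cos (2 * Real.pi * a)|) volume a b :=
    fun a b => Continuous.intervalIntegrable (by fun_prop) _ _
  rw [← intervalIntegral.integral_add_adjacent_intervals (hI _ (1/4)) (hI _ _)]
  have h1 : ∫ a in (-(1/4 : ℝ))..(1/4), |Real.cos (2 * Real.pi * a)| =
      ∫ a in (-(1/4 : ℝ))..(1/4), Real.cos (2 * Real.pi * a) := by
    refine intervalIntegral.integral_congr fun a ha => ?_
    rw [Set.uIcc_of_le (by norm_num)] at ha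
    obtain ⟨ha1, ha2⟩ := ha
    refine abs_of_nonneg (Real.cos_nonneg_of_neg_pi_div_two_le_of_le ?_ ?_) <;> nlinarith
  have h2 : ∫ a in (1/4 : ℝ)..(-(1/4) + 1), |Real.cos (2 * Real.pi * a)| =
      ∫ a in (1/4 : ℝ)..(-(1/4) + 1), -Real.cos (2 * Real.pi * a) := by
    refine intervalIntegral.integral_congr fun a ha => ?_
    rw [Set.uIcc_of_le (by norm_num)] at ha
    obtain ⟨ha1, ha2⟩ := ha
    refine abs_of_nonpos (Real.cos_nonpos_of_pi_div_two_le_of_le ?_ ?_) <;> nlinarith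
  rw [h1, h2, intervalIntegral.integral_neg, intervalIntegral.integral_comp_mul_left _ (by positivity),
    intervalIntegral.integral_comp_mul_left _ (by positivity), integral_cos, integral_cos]
  have e1 : 2 * Real.pi * (1/4) = Real.pi / 2 := by ring
  have e2 : 2 * Real.pi * (-(1/4)) = -(Real.pi / 2) := by ring
  have e3 : 2 * Real.pi * (-(1/4) + 1) = Real.pi / 2 + Real.pi := by ring
  rw [e1, e2, e3, Real.sin_neg, Real.sin_add_pi, Real.sin_pi_div_two]
  simp only [smul_eq_mul]
  field_simp
  norm_num

lemma int_abs_re (z : ℂ) : ∫ θ, |(fourier 1 θ * z).re| ∂mu0 = (2 / Real.pi) * ‖z‖ := by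
  set a : UnitAddCircle := ((z.arg / (2 * Real.pi) : ℝ) : UnitAddCircle) with ha
  have hz : z = ‖z‖ * (fourier 1 a : ℂ) := by
    conv_lhs => rw [← Complex.norm_mul_exp_arg_mul_I z]
    rw [ha, fourier_coe_apply]
    congr 2
    have : (Real.pi : ℂ) ≠ 0 := by exact_mod_cast Real.pi_ne_zero
    push_cast
    field_simp
  have : ∀ θ : UnitAddCircle, |(fourier 1 θ * z).re| = ‖z‖ * |(fourier 1 (θ + a) : ℂ).re| := by
    intro θ
    conv_lhs => rw [hz]
    rw [fourier_one_add, mul_left_comm, Complex.re_ofReal_mul, abs_mul, abs_norm]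
  simp only [this]
  rw [integral_const_mul, integral_add_right_eq_self (fun θ : UnitAddCircle => |(fourier 1 θ : ℂ).re|) a,
    int_abs_cos, mul_comm]

lemma norm_SS (n : ℕ) : ∫ x, ‖SS n x‖ ∂PP = Real.pi / 2 * ∫ x, |(SS n x).re| ∂PP := by
  have h1 : ∫ θ, ∫ x, |(fourier 1 θ * SS n x).re| ∂PP ∂mu0 = ∫ x, |(SS n x).re| ∂PP := by
    simp only [rot]
    simp
  rw [integral_integral_swap] at h1
  · simp only [int_abs_re] at h1
    rw [integral_const_mul] at h1
    rw [← h1]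
    have := Real.pi_ne_zero
    field_simp
  · refine Integrable.of_bound (C := (Real.sqrt n)⁻¹ * n) ?_ (Eventually.of_forall ?_)
    · refine Measurable.aestronglyMeasurable ?_
      refine Continuous.measurable ?_
      refine (Complex.continuous_re.comp ?_).abs
      exact ((fourier 1).continuous.comp continuous_fst).mul ((SS_cont n).comp continuous_snd)
    · rintro ⟨θ, x⟩
      simp only [Function.uncurry]
      rw [Real.norm_eq_abs, abs_abs]
      refine (Complex.abs_re_le_norm _).trans ?_
      rw [norm_mul, fnorm, one_mul]
      exact SS_bound n x

/-- The standardised coordinates. -/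
noncomputable def XX (k : ℕ) (x : ℕ → UnitAddCircle) : ℝ := Real.sqrt 2 * (fourier 1 (x k) : ℂ).re

/-- One-variable version of `XX`. -/
noncomputable def gg (y : UnitAddCircle) : ℝ := Real.sqrt 2 * (fourier 1 y : ℂ).re

lemma gg_cont : Continuous gg := by
  unfold gg
  exact continuous_const.mul (Complex.continuous_re.comp (fourier 1).continuous)

lemma XX_meas (k : ℕ) : Measurable (XX k) := by
  have hm : Measurable (fun x : ℕ → UnitAddCircle => x k) := measurable_pi_apply _
  exact gg_cont.measurable.comp hm

lemma int_fourier_re (k : ℤ) (hk : k ≠ 0) : ∫ y, (fourier k y : ℂ).re ∂mu0 = 0 := by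
  have h := int_fourier k
  rw [if_neg hk] at h
  have hi : Integrable (fun y => (fourier k y : ℂ)) mu0 :=
    (fourier k).continuous.integrable_of_hasCompactSupport (HasCompactSupport.of_compactSpace _)
  have := integral_re hi
  simp only [RCLike.re_to_complex] at this
  rw [this, h]; simp

lemma XX_mean (k : ℕ) : ∫ x, XX k x ∂PP = 0 := by
  have := int_eval gg gg_cont k
  change ∫ x, gg (x k) ∂PP = 0
  rw [this]
  simp only [gg]
  rw [integral_const_mul, int_fourier_re 1 one_ne_zero, mul_zero]

lemma XX_sq (k : ℕ) : ∫ x, (XX k x) ^ 2 ∂PP = 1 := by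
  have := int_eval (fun y => gg y ^ 2) (gg_cont.pow 2) k
  change ∫ x, gg (x k) ^ 2 ∂PP = 1
  rw [this]
  have h : ∀ y, gg y ^ 2 = 1 + (fourier 2 y : ℂ).re := by
    intro y
    have h2 : (fourier 2 y : ℂ) = fourier 1 y * fourier 1 y := by
      rw [← fourier_add]; norm_num
    have hn : (fourier 1 y : ℂ).re ^ 2 + (fourier 1 y : ℂ).im ^ 2 = 1 := by
      have := Complex.sq_norm (fourier 1 y : ℂ)
      rw [fnorm, Complex.normSq_apply] at this
      linarith
    rw [h2, Complex.mul_re, gg, mul_pow, Real.sq_sqrt (by norm_num)]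
    linarith
  simp only [h]
  rw [integral_add (by simp), int_fourier_re 2 two_ne_zero]
  · simp
  · exact (Complex.continuous_re.comp (fourier 2).continuous).integrable_of_hasCompactSupport
      (HasCompactSupport.of_compactSpace _)

lemma XX_bdd (k : ℕ) (x : ℕ → UnitAddCircle) : ‖XX k x‖ ≤ Real.sqrt 2 := by
  rw [XX, norm_mul, Real.norm_of_nonneg (Real.sqrt_nonneg _)]
  have := (Complex.abs_re_le_norm (fourier 1 (x k) : ℂ))
  rw [fnorm] at this
  rw [Real.norm_eq_abs]
  nlinarith [Real.sqrt_nonneg 2]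

lemma XX_memLp (k : ℕ) : MemLp (XX k) 2 PP :=
  MemLp.of_bound (XX_meas k).aestronglyMeasurable _ (Eventually.of_forall (XX_bdd k))

lemma XX_indep : iIndepFun XX PP :=
  indep0.comp (fun _ => gg) (fun _ => gg_cont.measurable)

lemma XX_ident (i : ℕ) : IdentDistrib (XX i) (XX 0) PP PP := by
  refine ⟨(XX_meas i).aemeasurable, (XX_meas 0).aemeasurable, ?_⟩
  have : ∀ k, PP.map (XX k) = mu0.map gg := by
    intro k
    have hm : Measurable (fun x : ℕ → UnitAddCircle => x k) := measurable_pi_apply _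
    rw [← Measure.infinitePi_map_eval (fun _ : ℕ => mu0) k, Measure.map_map gg_cont.measurable hm]
    rfl
  rw [this, this]

/-- Normalised real sums. -/
noncomputable def WW (n : ℕ) (x : ℕ → UnitAddCircle) : ℝ :=
  (Real.sqrt n)⁻¹ * ∑ k ∈ Finset.range n, XX k x

lemma WW_eq (n : ℕ) (x : ℕ → UnitAddCircle) : WW n x = Real.sqrt 2 * (SS n x).re := by
  simp only [WW, SS, XX]
  rw [← Finset.mul_sum, Complex.smul_re, Complex.re_sum, smul_eq_mul]
  ring

lemma WW_memLp (n : ℕ) : MemLp (WW n) 2 PP :=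
  (memLp_finsetSum _ fun k _ => XX_memLp k).const_mul _

lemma WW_sq (n : ℕ) : ∫ x, (WW n x) ^ 2 ∂PP ≤ 1 := by
  have hv := IndepFun.variance_sum (μ := PP) (X := XX) (s := Finset.range n)
    (fun i _ => XX_memLp i) (fun i _ j _ hij => XX_indep.indepFun hij)
  have h1 : ∀ k, Var[XX k; PP] = 1 := by
    intro k
    rw [variance_of_integral_eq_zero (XX_meas k).aemeasurable (XX_mean k), XX_sq]
  simp only [h1] at hv
  have hm : Measurable (∑ i ∈ Finset.range n, XX i) := by
    have := Finset.measurable_sum (Finset.range n) (fun i _ => XX_meas i)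
    convert this using 1
    funext x
    simp
  have h0 : ∫ x, (∑ i ∈ Finset.range n, XX i) x ∂PP = 0 := by
    simp only [Finset.sum_apply]
    rw [integral_finsetSum _ fun i _ => (XX_memLp i).integrable (by norm_num)]
    simp [XX_mean]
  rw [variance_of_integral_eq_zero hm.aemeasurable h0] at hv
  have : ∀ x, WW n x ^ 2 = ((Real.sqrt n)⁻¹) ^ 2 * (∑ i ∈ Finset.range n, XX i) x ^ 2 := by
    intro x
    rw [WW, mul_pow, Finset.sum_apply]
  simp only [this]
  rw [integral_const_mul, hv, inv_pow, Real.sq_sqrt (by positivity)]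
  simp
  rcases Nat.eq_zero_or_pos n with h | h
  · subst h; simp
  · rw [inv_mul_cancel₀ (by positivity)]

/-- Truncated absolute value. -/
noncomputable def trunc (K : ℝ) (hK : 0 ≤ K) : BoundedContinuousFunction ℝ ℝ :=
  BoundedContinuousFunction.ofNormedAddCommGroup (fun x => min |x| K) (by fun_prop) K (by
    intro x
    rw [Real.norm_of_nonneg (le_min (abs_nonneg _) hK)]
    exact min_le_right _ _)

lemma trunc_bd (K : ℝ) (hK : 0 < K) (x : ℝ) :
    0 ≤ |x| - trunc K hK.le x ∧ |x| - trunc K hK.le x ≤ x ^ 2 / K := by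
  change 0 ≤ |x| - min |x| K ∧ |x| - min |x| K ≤ x ^ 2 / K
  constructor
  · linarith [min_le_left |x| K]
  · rcases le_total |x| K with h | h
    · rw [min_eq_left h, sub_self]; positivity
    · rw [min_eq_right h, le_div_iff₀ hK, ← sq_abs]
      nlinarith [abs_nonneg x]

lemma trunc_int {Ω : Type*} [MeasurableSpace Ω] (P : Measure Ω) [IsProbabilityMeasure P]
    (f : Ω → ℝ) (hf : MemLp f 2 P) (h1 : ∫ x, f x ^ 2 ∂P ≤ 1) (K : ℝ) (hK : 0 < K) :
    |∫ x, |f x| ∂P - ∫ x, trunc K hK.le (f x) ∂P| ≤ 1 / K := by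
  have hi : Integrable (fun x => |f x|) P := (hf.integrable (by norm_num)).abs
  have ht : Integrable (fun x => trunc K hK.le (f x)) P := by
    refine Integrable.of_bound (C := ‖trunc K hK.le‖) ?_
      (Eventually.of_forall fun x => (trunc K hK.le).norm_coe_le_norm _)
    exact (trunc K hK.le).continuous.comp_aestronglyMeasurable hf.1
  rw [← integral_sub hi ht]
  have h0 : 0 ≤ ∫ x, (|f x| - trunc K hK.le (f x)) ∂P :=
    integral_nonneg fun x => (trunc_bd K hK (f x)).1
  rw [abs_of_nonneg h0]
  calc _ ≤ ∫ x, f x ^ 2 / K ∂P :=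
        integral_mono (hi.sub ht) (hf.integrable_sq.div_const K) fun x => (trunc_bd K hK (f x)).2
    _ ≤ 1 / K := by rw [integral_div]; gcongr

lemma gauss_abs : ∫ x, |x| ∂(gaussianReal 0 1) = Real.sqrt (2 / Real.pi) := by
  rw [integral_gaussianReal_eq_integral_smul one_ne_zero]
  have h : ∀ x : ℝ, gaussianPDFReal 0 1 x • |x| =
      (fun y : ℝ => (Real.sqrt (2 * Real.pi))⁻¹ * (y ^ (1 : ℝ) * Real.exp (-(1/2) * y ^ (2 : ℝ)))) |x| := by
    intro x
    simp only [gaussianPDFReal, smul_eq_mul, Real.rpow_one, Real.rpow_two, sq_abs]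
    simp only [NNReal.coe_one, mul_one, sub_zero]
    rw [show -x ^ 2 / 2 = -(1/2) * x ^ 2 by ring]
    ring
  simp only [h]
  rw [integral_comp_abs (f := fun y : ℝ => (Real.sqrt (2 * Real.pi))⁻¹ * (y ^ (1 : ℝ) * Real.exp (-(1/2) * y ^ (2 : ℝ)))),
    integral_const_mul, integral_rpow_mul_exp_neg_mul_rpow (by norm_num) (by norm_num) (by norm_num)]
  norm_num
  have h2 : Real.sqrt 2 * Real.sqrt 2 = 2 := Real.mul_self_sqrt (by norm_num)
  have : Real.sqrt Real.pi ≠ 0 := (Real.sqrt_pos.2 Real.pi_pos).ne'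
  field_simp
  nlinarith

lemma gauss_memLp : MemLp (fun x : ℝ => x) 2 (gaussianReal 0 1) :=
  memLp_id_gaussianReal 2

lemma gauss_sq : ∫ x, x ^ 2 ∂(gaussianReal 0 1) ≤ 1 := by
  have h := variance_id_gaussianReal (μ := 0) (v := 1)
  rw [variance_of_integral_eq_zero (by fun_prop) (by simp)] at h
  simp at h
  exact h.le

lemma clt : Tendsto (fun n => ∫ x, |WW n x| ∂PP) atTop (nhds (Real.sqrt (2 / Real.pi))) := by
  have hY : HasLaw (fun x : ℝ => x) (gaussianReal 0 1) (gaussianReal 0 1) := HasLaw.id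
  have hd := tendstoInDistribution_inv_sqrt_mul_sum hY (XX_mean 0) (XX_sq 0) XX_indep XX_ident
  have ht := ProbabilityMeasure.tendsto_iff_forall_integral_tendsto.1 hd.tendsto
  rw [← gauss_abs, Metric.tendsto_nhds]
  intro ε hε
  have hK : 0 < 3 / ε := by positivity
  have h := ht (trunc (3 / ε) hK.le)
  have e1 : ∀ n, ∫ y, trunc (3 / ε) hK.le y ∂(PP.map (WW n)) =
      ∫ x, trunc (3 / ε) hK.le (WW n x) ∂PP := fun n =>
    integral_map (WW_memLp n).1.aemeasurable
      (trunc (3 / ε) hK.le).continuous.aestronglyMeasurable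
  have e2 : (gaussianReal 0 1).map (fun x : ℝ => x) = gaussianReal 0 1 := Measure.map_id
  simp only [ProbabilityMeasure.coe_mk, e2] at h
  change Tendsto (fun n => ∫ y, trunc (3 / ε) hK.le y ∂(PP.map (WW n))) _ _ at h
  simp only [e1] at h
  filter_upwards [Metric.tendsto_nhds.1 h (ε / 3) (by positivity)] with n hn
  have a1 := trunc_int PP (WW n) (WW_memLp n) (WW_sq n) (3 / ε) hK
  have a2 := trunc_int (gaussianReal 0 1) (fun x => x) gauss_memLp gauss_sq (3 / ε) hK
  rw [Real.dist_eq] at hn ⊢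
  have a3 : 1 / (3 / ε) = ε / 3 := by field_simp
  rw [a3] at a1 a2
  rw [abs_lt] at hn ⊢
  rw [abs_le] at a1 a2
  constructor <;> linarith [a1.1, a1.2, a2.1, a2.2, hn.1, hn.2]

lemma SS_lim : Tendsto (fun n => ∫ x, ‖SS n x‖ ∂PP) atTop (nhds (Real.sqrt Real.pi / 2)) := by
  have h := clt.const_mul (Real.pi / 2 / Real.sqrt 2)
  have h2 : Real.sqrt 2 ≠ 0 := by positivity
  have e : Real.pi / 2 / Real.sqrt 2 * Real.sqrt (2 / Real.pi) = Real.sqrt Real.pi / 2 := by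
    have hp : Real.sqrt Real.pi ≠ 0 := (Real.sqrt_pos.2 Real.pi_pos).ne'
    have hpp : Real.sqrt Real.pi * Real.sqrt Real.pi = Real.pi := Real.mul_self_sqrt Real.pi_pos.le
    rw [Real.sqrt_div (by norm_num)]
    field_simp
    nlinarith
  rw [e] at h
  refine h.congr fun n => ?_
  simp only [WW_eq, abs_mul, abs_of_nonneg (Real.sqrt_nonneg 2)]
  rw [integral_const_mul, norm_SS]
  field_simp

end L1Flat

namespace L1Flat

/-- The finite-torus version of the norm of the Steinhaus sum. -/
noncomputable def FF (q : ℕ) : C(UnitAddTorus (Fin q), ℂ) where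
  toFun y := ((‖((Real.sqrt q)⁻¹ : ℝ) • ∑ j : Fin q, (fourier 1 (y j) : ℂ)‖ : ℝ) : ℂ)
  continuous_toFun := by
    have h : Continuous (fun y : UnitAddTorus (Fin q) => ∑ j : Fin q, (fourier 1 (y j) : ℂ)) := by
      refine continuous_finsetSum _ fun j _ => ?_
      exact (fourier 1).continuous.comp (continuous_apply j)
    exact Complex.continuous_ofReal.comp (h.const_smul ((Real.sqrt q)⁻¹ : ℝ)).norm

lemma mean (q : ℕ) (ω : ℕ → ℝ) (hind : LinearIndependent ℚ (fun j : Fin q => ω j)) :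
    HasMeanValue
        (fun t : ℝ =>
          ‖(Real.sqrt q)⁻¹ •
            ∑ j ∈ Finset.range q, Complex.exp (Complex.I * ω j * t)‖) (∫ x, ‖SS q x‖ ∂PP) := by
  have h := weyl _ hind (FF q)
  have e1 : sav (FF q) = ((∫ x, ‖SS q x‖ ∂PP : ℝ) : ℂ) := by
    rw [sav, ← integral_complex_ofReal]
    refine integral_congr_ae (Eventually.of_forall fun x => ?_)
    simp only [FF, SS, ContinuousMap.coe_mk]
    rw [Finset.sum_range]
  have e2 : ∀ T, tav (fun j : Fin q => ω j) T (FF q) = (((1 / (2 * T)) * ∫ t in (-T)..T,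
      ‖(Real.sqrt q)⁻¹ • ∑ j ∈ Finset.range q, Complex.exp (Complex.I * ω j * t)‖ : ℝ) : ℂ) := by
    intro T
    rw [tav, Complex.ofReal_mul, ← intervalIntegral.integral_ofReal]
    congr 1
    refine intervalIntegral.integral_congr fun t _ => ?_
    simp only [FF, ContinuousMap.coe_mk, gam]
    rw [Finset.sum_range]
    congr 4
    funext j
    rw [fourier_coe_apply]
    congr 1
    have : (Real.pi : ℂ) ≠ 0 := by exact_mod_cast Real.pi_ne_zero
    push_cast
    field_simp
  rw [e1] at h
  simp only [e2] at h
  have := (Complex.continuous_re.tendsto _).comp h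
  simp only [Function.comp_def, Complex.ofReal_re] at this
  exact this

end L1Flat

/-- If for each `n` the frequencies `ω_n(0), …, ω_n(q_n − 1)` are rationally independent and
`q_n → ∞`, then the asymptotic mean value of `|(1/√q_n) ∑_j e^{iω_n(j)t}|` converges to
`√π/2 < 1` as `n → ∞`; in particular no such sequence of polynomials is `L¹`-flat. -/
theorem no_L1_flat_with_independent_frequencies
    (q : ℕ → ℕ) (ω : ℕ → ℕ → ℝ)
    (hind : ∀ n : ℕ, LinearIndependent ℚ (fun j : Fin (q n) => ω n j))
    (hq : Tendsto q atTop atTop) :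
    ∃ m : ℕ → ℝ,
      (∀ n : ℕ, HasMeanValue
        (fun t : ℝ =>
          ‖(Real.sqrt (q n))⁻¹ •
            ∑ j ∈ Finset.range (q n), Complex.exp (Complex.I * ω n j * t)‖) (m n)) ∧
      Tendsto m atTop (nhds (Real.sqrt Real.pi / 2)) ∧
      Real.sqrt Real.pi / 2 < 1 := by
  refine ⟨fun n => ∫ x, ‖L1Flat.SS (q n) x‖ ∂L1Flat.PP, fun n => ?_, L1Flat.SS_lim.comp hq, ?_⟩
  · exact L1Flat.mean (q n) (ω n) (hind n)
  · have h : Real.sqrt Real.pi < 2 := by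
      rw [Real.sqrt_lt' (by norm_num)]
      linarith [Real.pi_lt_four]
    linarith
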